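/- For a, b ∈ ℂ, let S(a,b) be the 4×4 symmetric matrix of the quadratic form a(w₀w₁ − w₂²) + b(w₃² − 4w₁w₂ + w₀w₂), i.e. the matrix with rows (0, a/2, b/2, 0), (a/2, 0, −2b, 0), (b/2, −2b, −a, 0), (0, 0, 0, b). Then det S(a,b) = (1/4)·a·b·(a − 2b)·(a + 2b). In particular, S(a,b) is singular with (a,b) ≠ (0,0) exactly when the ratio (a : b) is one of the four values (1 : 0), (0 : 1), (2 : 1), (−2 : 1); consequently the pencil of quadrics through the curve contains exactly four singular members. -/

import Mathlib

/-- The symmetric matrix `S(a,b)` of the quadratic form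
`a(w₀w₁ - w₂²) + b(w₃² - 4w₁w₂ + w₀w₂)`, the general member of the pencil of quadrics
through the embedded elliptic curve `C₄`. -/
noncomputable def Spencil (a b : ℂ) : Matrix (Fin 4) (Fin 4) ℂ :=
  !![0, a/2, b/2, 0;
     a/2, 0, -2*b, 0;
     b/2, -2*b, -a, 0;
     0, 0, 0, b]

theorem Projectivization.mk_eq_mk_iff_mul_eq_mul {K : Type*} [Field K] {u v : K × K}
    (hu : u ≠ 0) (hv : v ≠ 0) :
    Projectivization.mk K u hu = Projectivization.mk K v hv ↔ u.1 * v.2 = u.2 * v.1 := by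
  rw [Projectivization.mk_eq_mk_iff']
  obtain ⟨a, b⟩ := u
  obtain ⟨c, d⟩ := v
  constructor
  · rintro ⟨t, ht⟩
    simp only [Prod.smul_mk, smul_eq_mul, Prod.mk.injEq] at ht
    obtain ⟨rfl, rfl⟩ := ht
    ring
  · intro h
    dsimp only at h
    by_cases hc : c = 0
    · have hd : d ≠ 0 := fun hd => hv (by simp [hc, hd])
      refine ⟨b / d, Prod.ext ?_ ?_⟩
      · have ha : a = 0 := by simpa [hc, hd] using h
        simp [ha, hc]
      · simp [hd]
    · refine ⟨a / c, Prod.ext ?_ ?_⟩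
      · simp [hc]
      · simp only [Prod.smul_mk, smul_eq_mul]
        field_simp
        linear_combination h

theorem Projectivization.eq_mk_iff_rep_mul_eq_mul {K : Type*} [Field K]
    (p : Projectivization K (K × K)) {v : K × K} (hv : v ≠ 0) :
    p = Projectivization.mk K v hv ↔ p.rep.1 * v.2 = p.rep.2 * v.1 := by
  rw [← Projectivization.mk_eq_mk_iff_mul_eq_mul p.rep_nonzero hv, p.mk_rep]

theorem det_Spencil (a b : ℂ) :
    (Spencil a b).det = (1/4) * a * b * (a - 2*b) * (a + 2*b) := by
  simp [Spencil, Matrix.det_succ_row_zero, Fin.sum_univ_succ, Fin.succAbove]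
  ring

theorem det_Spencil_eq_zero_iff (a b : ℂ) :
    (Spencil a b).det = 0 ↔ b = 0 ∨ a = 0 ∨ a = 2*b ∨ a = -2*b := by
  have h : a + 2*b = 0 ↔ a = -2*b := by rw [add_eq_zero_iff_eq_neg, neg_mul]
  rw [det_Spencil, mul_eq_zero, mul_eq_zero, mul_eq_zero, mul_eq_zero, sub_eq_zero, h]
  norm_num
  tauto

theorem setOf_det_Spencil_rep_eq_zero :
    {p : Projectivization ℂ (ℂ × ℂ) | (Spencil p.rep.1 p.rep.2).det = 0} =
      {Projectivization.mk ℂ (1, 0) (by simp), Projectivization.mk ℂ (0, 1) (by simp),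
        Projectivization.mk ℂ (2, 1) (by simp), Projectivization.mk ℂ (-2, 1) (by simp)} := by
  ext p
  simp only [Set.mem_ofPred_eq, Set.mem_insert_iff, Set.mem_singleton_iff,
    Projectivization.eq_mk_iff_rep_mul_eq_mul, det_Spencil_eq_zero_iff, mul_one, mul_zero,
    mul_comm p.rep.2, one_mul, zero_mul, eq_comm (a := (0 : ℂ))]

/-- `det S(a,b) = (1/4)·a·b·(a-2b)·(a+2b)`; hence for `(a,b) ≠ (0,0)` the matrix `S(a,b)`
is singular exactly when `(a : b)` is one of `(1 : 0)`, `(0 : 1)`, `(2 : 1)`, `(-2 : 1)`,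
and the pencil of quadrics through the curve contains exactly four singular members. -/
theorem stmt_15 :
    (∀ a b : ℂ, (Spencil a b).det = (1/4) * a * b * (a - 2*b) * (a + 2*b)) ∧
    (∀ a b : ℂ, (a, b) ≠ (0, 0) →
      ((Spencil a b).det = 0 ↔ b = 0 ∨ a = 0 ∨ a = 2*b ∨ a = -2*b)) ∧
    {p : Projectivization ℂ (ℂ × ℂ) | (Spencil p.rep.1 p.rep.2).det = 0}.ncard = 4 := by
  refine ⟨det_Spencil, fun a b _ => det_Spencil_eq_zero_iff a b, ?_⟩
  rw [setOf_det_Spencil_rep_eq_zero, Set.ncard_insert_of_notMem, Set.ncard_insert_of_notMem,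
    Set.ncard_pair]
  all_goals
    simp only [ne_eq, Set.mem_insert_iff, Set.mem_singleton_iff,
      Projectivization.mk_eq_mk_iff_mul_eq_mul]
    norm_num
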